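/- For every topological space X, the cellular spectrum of X equals the cellular spectrum of the preorder 𝕆_X of nonempty open subsets of X: an infinite cardinal κ satisfies (for every topological space Y, c(Y) ≤ κ implies c(X × Y) ≤ κ) if and only if (for every preorder ℚ, c(ℚ) ≤ κ implies c(𝕆_X × ℚ) ≤ κ). -/

import Mathlib

universe u

/-- Two elements of a preorder are *compatible* if they have a common lower bound. -/
def PCompat {α : Type u} [Preorder α] (p q : α) : Prop := ∃ r, r ≤ p ∧ r ≤ q

/-- An *antichain*: a set of pairwise incompatible elements. -/
def PAntichain {α : Type u} [Preorder α] (A : Set α) : Prop :=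
  A.Pairwise fun p q => ¬ PCompat p q

/-- The *cellularity* of a preorder: the supremum of ℵ₀ and the cardinalities of antichains. -/
noncomputable def cellularity (α : Type u) [Preorder α] : Cardinal.{u} :=
  max Cardinal.aleph0
    (sSup {c : Cardinal.{u} | ∃ A : Set α, PAntichain A ∧ c = Cardinal.mk ↑A})

/-- The *cellular spectrum* of a preorder: the infinite cardinals κ such that the product
with any preorder of cellularity at most κ has cellularity at most κ. -/
def cellSpec (α : Type u) [Preorder α] : Set Cardinal.{u} :=
  {κ | Cardinal.aleph0 ≤ κ ∧
    ∀ (β : Type u) [Preorder β], cellularity β ≤ κ → cellularity (α × β) ≤ κ}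

/-- The poset 𝕆_X of nonempty open subsets of a topological space, ordered by inclusion. -/
abbrev SpaceOpens (X : Type u) (t : TopologicalSpace X) : Type u :=
  {U : Set X // t.IsOpen U ∧ U.Nonempty}

theorem cellularity_le_iff {α : Type u} [Preorder α] {κ : Cardinal.{u}}
    (hκ : Cardinal.aleph0 ≤ κ) :
    cellularity α ≤ κ ↔ ∀ A : Set α, PAntichain A → Cardinal.mk ↑A ≤ κ := by
  unfold cellularity
  rw [max_le_iff]
  constructor
  · rintro ⟨-, h⟩ A hA
    refine (le_csSup ?_ (show _ ∈ {c : Cardinal.{u} | ∃ A : Set α, PAntichain A ∧ c = Cardinal.mk ↑A}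
      from ⟨A, hA, rfl⟩)).trans h
    refine ⟨Cardinal.mk α, ?_⟩
    rintro c ⟨B, -, rfl⟩
    exact Cardinal.mk_set_le B
  · intro h
    refine ⟨hκ, csSup_le' ?_⟩
    rintro c ⟨B, hB, rfl⟩
    exact h B hB

theorem cellularity_le_of_map {α β : Type u} [Preorder α] [Preorder β] {κ : Cardinal.{u}}
    (hκ : Cardinal.aleph0 ≤ κ) (f : α → β)
    (hf : ∀ p q, PCompat (f p) (f q) → PCompat p q) (h : cellularity β ≤ κ) :
    cellularity α ≤ κ := by
  rw [cellularity_le_iff hκ] at h ⊢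
  intro A hA
  have hinj : Set.InjOn f A := by
    intro a ha b hb hab
    by_contra hne
    exact hA ha hb hne (hf a b ⟨f a, le_rfl, hab.le⟩)
  rw [← Cardinal.mk_image_eq_of_injOn f A hinj]
  apply h
  rintro _ ⟨a, ha, rfl⟩ _ ⟨b, hb, rfl⟩ hne hc
  exact hA ha hb (fun e => hne (e ▸ rfl)) (hf a b hc)

theorem pcompat_opens_iff {X : Type u} (t : TopologicalSpace X) (U V : SpaceOpens X t) :
    PCompat U V ↔ (U.1 ∩ V.1).Nonempty := by
  constructor
  · rintro ⟨W, h1, h2⟩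
    obtain ⟨x, hx⟩ := W.2.2
    exact ⟨x, h1 hx, h2 hx⟩
  · intro h
    exact ⟨⟨U.1 ∩ V.1, t.isOpen_inter _ _ U.2.1 V.2.1, h⟩,
      fun _ hx => hx.1, fun _ hx => hx.2⟩

/-- The topology of lower sets. -/
def lowerTop (β : Type u) [Preorder β] : TopologicalSpace β where
  IsOpen U := IsLowerSet U
  isOpen_univ := isLowerSet_univ
  isOpen_inter _ _ h1 h2 := h1.inter h2
  isOpen_sUnion _ h := isLowerSet_sUnion h

/-- The cellular spectrum of a topological space equals that of its poset of nonempty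
open sets. -/
theorem spec_space_eq_spec_opens {X : Type u} [tX : TopologicalSpace X] (κ : Cardinal.{u})
    (hκ : Cardinal.aleph0 ≤ κ) :
    (∀ (Y : Type u) [tY : TopologicalSpace Y],
        cellularity (SpaceOpens Y tY) ≤ κ →
        cellularity (SpaceOpens (X × Y) (inferInstance : TopologicalSpace (X × Y))) ≤ κ) ↔
      κ ∈ cellSpec (SpaceOpens X tX) := by
  constructor
  · intro H
    refine ⟨hκ, fun β _ hβ => ?_⟩
    letI tβ : TopologicalSpace β := lowerTop β
    have h1 : cellularity (SpaceOpens β tβ) ≤ κ := by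
      refine cellularity_le_of_map hκ (fun U => U.2.2.some) ?_ hβ
      rintro U V ⟨r, hU, hV⟩
      rw [pcompat_opens_iff]
      exact ⟨r, (show IsLowerSet U.1 from U.2.1) hU U.2.2.some_mem,
        (show IsLowerSet V.1 from V.2.1) hV V.2.2.some_mem⟩
    have hIic : ∀ q : β, IsOpen (Set.Iic q) := fun q => isLowerSet_Iic q
    refine cellularity_le_of_map hκ
      (fun p => ⟨p.1.1 ×ˢ Set.Iic p.2, IsOpen.prod p.1.2.1 (hIic p.2),
        p.1.2.2.prod ⟨p.2, le_rfl⟩⟩) ?_ (H β h1)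
    rintro ⟨U, p⟩ ⟨V, q⟩ h
    rw [pcompat_opens_iff] at h
    obtain ⟨⟨x, r⟩, ⟨hxU, hrp⟩, ⟨hxV, hrq⟩⟩ := h
    obtain ⟨W, hWU, hWV⟩ := (pcompat_opens_iff tX U V).2 ⟨x, hxU, hxV⟩
    exact ⟨(W, r), ⟨hWU, hrp⟩, ⟨hWV, hrq⟩⟩
  · rintro ⟨-, H⟩ Y tY hY
    have key : ∀ W : SpaceOpens (X × Y) (inferInstance : TopologicalSpace (X × Y)),
        ∃ p : SpaceOpens X tX × SpaceOpens Y tY, p.1.1 ×ˢ p.2.1 ⊆ W.1 := by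
      rintro ⟨W, hW, ⟨x, y⟩, hxy⟩
      obtain ⟨u, v, hu, hv, hx, hy, hs⟩ := isOpen_prod_iff.1 hW x y hxy
      exact ⟨(⟨u, hu, x, hx⟩, ⟨v, hv, y, hy⟩), hs⟩
    choose f hf using key
    refine cellularity_le_of_map hκ f ?_ (H _ hY)
    rintro W W' ⟨⟨U, V⟩, ⟨h1, h2⟩, ⟨h3, h4⟩⟩
    rw [pcompat_opens_iff]
    obtain ⟨x, hx⟩ := U.2.2
    obtain ⟨y, hy⟩ := V.2.2
    exact ⟨(x, y), hf W ⟨h1 hx, h2 hy⟩, hf W' ⟨h3 hx, h4 hy⟩⟩
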